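/- arXiv:1210.3195 — 2 statements merged into one kernel-verified Lean document; each statement's English description precedes it below -/
import Mathlib

section
/- For every t ∈ ℂ and every point (x, y) ∈ ℂ² satisfying y² = x⁵ + (1+9t)x⁴ + 33t·x³ + 40t·x² + 16t·x with 3x+4 ≠ 0, the point (X, Y) = (x³/(3x+4)², x(x+4)y/(3x+4)³) satisfies Y² = X·(X+1)·(X+t). (This is the genus-2 family of totally ramified origamis f : C_t → E_t constructed by the degeneration method.) -/
/-- The genus-2 family: the map `f(x,y) = (x³/(3x+4)², x(x+4)y/(3x+4)³)` sends the
genus-2 curve `C_t : y² = x⁵+(1+9t)x⁴+33tx³+40tx²+16tx` to `E_t : y² = x(x+1)(x+t)`. -/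
theorem genus_two_origami (t x y : ℂ)
    (hC : y ^ 2 = x ^ 5 + (1 + 9 * t) * x ^ 4 + 33 * t * x ^ 3 + 40 * t * x ^ 2 + 16 * t * x)
    (hd : 3 * x + 4 ≠ 0) :
    (x * (x + 4) * y / (3 * x + 4) ^ 3) ^ 2 =
      (x ^ 3 / (3 * x + 4) ^ 2) * ((x ^ 3 / (3 * x + 4) ^ 2) + 1) *
        ((x ^ 3 / (3 * x + 4) ^ 2) + t) := by
  have hd2 : (3 * x + 4) ^ 2 ≠ 0 := pow_ne_zero 2 hd
  rw [div_add' _ _ _ hd2, div_add' _ _ _ hd2, div_mul_div_comm, div_mul_div_comm, div_pow,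
    mul_pow, hC]
  congr 1 <;> ring
end

section
/- For every point (x, y) ∈ ℂ² satisfying y² = x⁵ + x⁴ with 3x+4 ≠ 0, the point (X, Y) = (x³/(3x+4)², x(x+4)y/(3x+4)³) satisfies Y² = X³ + X². (That is, the map f(x,y) = (x³/(3x+4)², xy(x+4)/(3x+4)³) sends the nodal quintic C′ : y² = x⁵ + x⁴ to the nodal cubic E′ : y² = x³ + x².) -/
/-- The map `f(x,y) = (x³/(3x+4)², xy(x+4)/(3x+4)³)` sends the nodal quintic
`C′ : y² = x⁵ + x⁴` to the nodal cubic `E′ : y² = x³ + x²`. -/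
theorem degenerate_cover (x y : ℂ)
    (hC : y ^ 2 = x ^ 5 + x ^ 4) (hd : 3 * x + 4 ≠ 0) :
    (x * (x + 4) * y / (3 * x + 4) ^ 3) ^ 2 =
      (x ^ 3 / (3 * x + 4) ^ 2) ^ 3 + (x ^ 3 / (3 * x + 4) ^ 2) ^ 2 := by
  have hX : (x ^ 3 / (3 * x + 4) ^ 2) ^ 2 = x ^ 6 * (3 * x + 4) ^ 2 / (3 * x + 4) ^ 6 := by
    rw [div_pow, div_eq_div_iff (pow_ne_zero _ (pow_ne_zero _ hd)) (pow_ne_zero _ hd)]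
    ring
  rw [hX, div_pow, div_pow, ← pow_mul, ← pow_mul, ← pow_mul, ← add_div]
  congr 1
  linear_combination (x * (x + 4)) ^ 2 * hC
end
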